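/- Let $p \in (0,1)$, $q \in (0,\infty]$, $\nu > d(1/p-1)$. Suppose $f, \tilde{f}$ are distributions on $\mathbb{R}^d$ and $\xi$ is a smooth compactly supported function with $\int \xi = 1$ such that for all $k \ge 0$, $\left\| x \mapsto \fint_{B(x,2^{-k})} |(f-\tilde f)*\xi^{(k)}(y)|\,dy \right\|_{L^p(\mathbb{R}^d)} \leq M 2^{-\nu k}$ for some constant $M$. Then $f = \tilde f$. -/

import Mathlib

open MeasureTheory ENNReal Filter

/-- A distribution on `ℝ^d`: a linear functional on functions, together with sequential
continuity on test functions in the sense of `𝓓(ℝ^d)`. -/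
structure DistributionR (d : ℕ) where
  toFun : ((Fin d → ℝ) → ℝ) →ₗ[ℝ] ℝ
  cont' : ∀ (φ : ℕ → (Fin d → ℝ) → ℝ) (φ₀ : (Fin d → ℝ) → ℝ),
    (∀ n, ContDiff ℝ (⊤ : ℕ∞) (φ n)) → ContDiff ℝ (⊤ : ℕ∞) φ₀ →
    (∃ K : Set (Fin d → ℝ), IsCompact K ∧ ∀ n, tsupport (φ n) ⊆ K) →
    (∀ m : ℕ, TendstoUniformly (fun n => iteratedFDeriv ℝ m (φ n))
      (iteratedFDeriv ℝ m φ₀) atTop) →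
    Tendsto (fun n => toFun (φ n)) atTop (nhds (toFun φ₀))

/-- Equality of distributions: agreement on all test functions. -/
def DistributionR.EqD {d : ℕ} (f g : DistributionR d) : Prop :=
  ∀ φ : (Fin d → ℝ) → ℝ, ContDiff ℝ (⊤ : ℕ∞) φ → HasCompactSupport φ → f.toFun φ = g.toFun φ

/-- `L^1`-normalized dilation `ξ^{(k)}(y) = 2^{dk} ξ(2^k y)`. -/
noncomputable def dil (d : ℕ) (k : ℕ) (ξ : (Fin d → ℝ) → ℝ) : (Fin d → ℝ) → ℝ :=
  fun y => (2 : ℝ) ^ (d * k) * ξ (((2 : ℝ) ^ k) • y)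

/-- Convolution of a distribution with a test function: `(f * η)(x) = f(η(x - ·))`. -/
noncomputable def distribConv {d : ℕ} (f : DistributionR d)
    (η : (Fin d → ℝ) → ℝ) (x : Fin d → ℝ) : ℝ :=
  f.toFun (fun y => η (x - y))

section aux
open Topology

lemma aux_hasFDeriv {d : ℕ} {V : Type*} [NormedAddCommGroup V] [NormedSpace ℝ V]
    (c : (Fin d → ℝ) → ℝ) (hc : Continuous c) (hcc : HasCompactSupport c)
    (ψ : (Fin d → ℝ) → V) (hψ : ContDiff ℝ 1 ψ) (hψc : HasCompactSupport ψ) (t : ℝ)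
    (y : Fin d → ℝ) :
    HasFDerivAt (fun y => ∫ x, c x • ψ (y + t • x)) (∫ x, c x • fderiv ℝ ψ (y + t • x)) y := by
  have hψ' : Continuous (fderiv ℝ ψ) := hψ.continuous_fderiv (by norm_num)
  have hψ0 : Continuous ψ := hψ.continuous
  obtain ⟨B, hB⟩ := (hψc.fderiv ℝ).exists_bound_of_continuous hψ'
  refine hasFDerivAt_integral_of_dominated_of_fderiv_le (s := Set.univ)
    (F := fun y x => c x • ψ (y + t • x)) (F' := fun y x => c x • fderiv ℝ ψ (y + t • x))
    (bound := fun x => ‖c x‖ * B) Filter.univ_mem ?_ ?_ ?_ ?_ ?_ ?_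
  · refine Eventually.of_forall fun z => ?_
    exact (Continuous.aestronglyMeasurable (by fun_prop))
  · exact Continuous.integrable_of_hasCompactSupport (by fun_prop) hcc.smul_right
  · exact (Continuous.aestronglyMeasurable (by fun_prop))
  · refine Eventually.of_forall fun x z _ => ?_
    rw [norm_smul]
    gcongr
    exact hB _
  · exact (hc.norm.integrable_of_hasCompactSupport hcc.norm).mul_const B
  · refine Eventually.of_forall fun x z _ => ?_
    have h1 : HasFDerivAt ψ (fderiv ℝ ψ (z + t • x)) (z + t • x) :=
      (hψ.differentiable (by norm_num) _).hasFDerivAt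
    have h2 : HasFDerivAt (fun y => ψ (y + t • x)) (fderiv ℝ ψ (z + t • x)) z := by
      rw [hasFDerivAt_comp_add_right]
      exact h1
    exact h2.const_smul (c x)

lemma aux_fderiv_apply {d : ℕ} {V : Type*} [NormedAddCommGroup V] [NormedSpace ℝ V]
    [CompleteSpace V]
    (c : (Fin d → ℝ) → ℝ) (hc : Continuous c) (hcc : HasCompactSupport c)
    (ψ : (Fin d → ℝ) → V) (hψ : ContDiff ℝ 1 ψ) (hψc : HasCompactSupport ψ) (t : ℝ)
    (y v : Fin d → ℝ) :
    fderiv ℝ (fun y => ∫ x, c x • ψ (y + t • x)) y v = ∫ x, c x • fderiv ℝ ψ (y + t • x) v := by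
  rw [(aux_hasFDeriv c hc hcc ψ hψ hψc t y).fderiv, ContinuousLinearMap.integral_apply]
  · rfl
  · have := hψ.continuous_fderiv (by norm_num)
    exact Continuous.integrable_of_hasCompactSupport (by fun_prop) hcc.smul_right

lemma aux_iter {d : ℕ} 
    (c : (Fin d → ℝ) → ℝ) (hc : Continuous c) (hcc : HasCompactSupport c)
    (ψ : (Fin d → ℝ) → ℝ) (hψ : ContDiff ℝ (⊤ : ℕ∞) ψ) (hψc : HasCompactSupport ψ) (t : ℝ)
    (m : ℕ) :
    iteratedFDeriv ℝ m (fun y => ∫ x, c x • ψ (y + t • x)) =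
      fun y => ∫ x, c x • iteratedFDeriv ℝ m ψ (y + t • x) := by
  induction m with
  | zero =>
    ext1 y
    rw [iteratedFDeriv_zero_eq_comp, Function.comp_apply]
    rw [← LinearIsometryEquiv.coe_toContinuousLinearEquiv, ← ContinuousLinearEquiv.integral_comp_comm]
    congr 1
  | succ m ih =>
    ext1 y
    have hm : ContDiff ℝ 1 (iteratedFDeriv ℝ m ψ) :=
      hψ.iteratedFDeriv_right (by exact_mod_cast le_top)
    have hi2 : Integrable (fun x => c x • iteratedFDeriv ℝ (m + 1) ψ (y + t • x)) := by
      have : Continuous (iteratedFDeriv ℝ (m + 1) ψ) :=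
        hψ.continuous_iteratedFDeriv (by exact_mod_cast le_top)
      exact Continuous.integrable_of_hasCompactSupport (by fun_prop) hcc.smul_right
    ext v
    rw [ContinuousMultilinearMap.integral_apply hi2, iteratedFDeriv_succ_apply_left, ih,
      aux_fderiv_apply c hc hcc _ hm (hψc.iteratedFDeriv m) t y,
      ContinuousMultilinearMap.integral_apply]
    · rfl
    · have h1 := hm.continuous_fderiv (by norm_num)
      have h2 : Continuous fun z => fderiv ℝ (iteratedFDeriv ℝ m ψ) z (v 0) :=
        h1.clm_apply continuous_const
      exact Continuous.integrable_of_hasCompactSupport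
        (hc.smul (h2.comp (by fun_prop : Continuous fun x => y + t • x))) hcc.smul_right

lemma aux_contDiff {d : ℕ} 
    (c : (Fin d → ℝ) → ℝ) (hc : Continuous c) (hcc : HasCompactSupport c)
    (ψ : (Fin d → ℝ) → ℝ) (hψ : ContDiff ℝ (⊤ : ℕ∞) ψ) (hψc : HasCompactSupport ψ) (t : ℝ) :
    ContDiff ℝ (⊤ : ℕ∞) (fun y => ∫ x, c x • ψ (y + t • x)) := by
  refine contDiff_of_differentiable_iteratedFDeriv fun m _ => ?_
  rw [aux_iter c hc hcc ψ hψ hψc t m]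
  have hm : ContDiff ℝ 1 (iteratedFDeriv ℝ m ψ) :=
      hψ.iteratedFDeriv_right (by exact_mod_cast le_top)
  exact fun y => (aux_hasFDeriv c hc hcc _ hm (hψc.iteratedFDeriv m) t y).differentiableAt

/-- approximate identity convergence -/
lemma aux_approx {d : ℕ} (G : DistributionR d)
    (ξ : (Fin d → ℝ) → ℝ) (hξ : Continuous ξ) (hξc : HasCompactSupport ξ) (hξ1 : ∫ y, ξ y = 1)
    (φ : (Fin d → ℝ) → ℝ) (hφ : ContDiff ℝ (⊤ : ℕ∞) φ) (hφc : HasCompactSupport φ) :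
    Tendsto (fun k : ℕ => G.toFun (fun y => ∫ w, ξ w • φ (y + ((2 : ℝ) ^ k)⁻¹ • w))) atTop
      (𝓝 (G.toFun φ)) := by
  obtain ⟨R, hR⟩ := hξc.isCompact.isBounded.subset_closedBall (0 : Fin d → ℝ)
  obtain ⟨S, hS⟩ := hφc.isCompact.isBounded.subset_closedBall (0 : Fin d → ℝ)
  have hR' : ∀ w, ξ w ≠ 0 → ‖w‖ ≤ R := fun w hw => by
    simpa using hR (subset_tsupport _ hw)
  have hS' : ∀ w, φ w ≠ 0 → ‖w‖ ≤ S := fun w hw => by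
    simpa using hS (subset_tsupport _ hw)
  have h2 : ∀ k : ℕ, ((2 : ℝ) ^ k)⁻¹ ≤ 1 := fun k => inv_le_one_of_one_le₀ (one_le_pow₀ (by norm_num))
  apply G.cont'
  · intro k
    exact aux_contDiff ξ hξ hξc φ hφ hφc _
  · exact hφ
  · refine ⟨Metric.closedBall 0 (S + R), isCompact_closedBall _ _, fun k => ?_⟩
    refine closure_minimal ?_ Metric.isClosed_closedBall
    intro y hy
    by_contra hy'
    apply hy
    refine integral_eq_zero_of_ae (Eventually.of_forall fun w => ?_)
    by_contra hne
    have hne' : ξ w ≠ 0 ∧ φ (y + ((2 : ℝ) ^ k)⁻¹ • w) ≠ 0 := by simpa using hne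
    apply hy'
    have e1 := hR' _ hne'.1
    have e2 := hS' _ hne'.2
    rw [mem_closedBall_zero_iff]
    have e3 : ‖((2 : ℝ) ^ k)⁻¹ • w‖ ≤ R := by
      rw [norm_smul, Real.norm_of_nonneg (by positivity)]
      calc _ ≤ 1 * ‖w‖ := by gcongr; exact h2 k
        _ ≤ R := by linarith
    calc ‖y‖ = ‖(y + ((2 : ℝ) ^ k)⁻¹ • w) - ((2 : ℝ) ^ k)⁻¹ • w‖ := by simp
      _ ≤ _ := norm_sub_le _ _
      _ ≤ _ := by linarith
  · intro m
    simp_rw [aux_iter ξ hξ hξc φ hφ hφc _ m]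
    have hcm : Continuous (iteratedFDeriv ℝ m φ) :=
      hφ.continuous_iteratedFDeriv (by exact_mod_cast le_top)
    have hu := (hφc.iteratedFDeriv m).uniformContinuous_of_continuous hcm
    rw [Metric.uniformContinuous_iff] at hu
    rw [Metric.tendstoUniformly_iff]
    intro ε hε
    set I := ∫ w, ‖ξ w‖ with hI
    have hI0 : 0 ≤ I := integral_nonneg fun _ => norm_nonneg _
    obtain ⟨δ, hδ, hd⟩ := hu (ε / (I + 1)) (by positivity)
    have ht : Tendsto (fun k : ℕ => ((2 : ℝ) ^ k)⁻¹ * (|R| + 1)) atTop (𝓝 0) := by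
      have := (tendsto_inv_atTop_zero.comp (tendsto_pow_atTop_atTop_of_one_lt (r := (2:ℝ)) (by norm_num))).mul_const (|R| + 1)
      simpa using this
    filter_upwards [ht.eventually_lt_const hδ] with k hk y
    have hint : Integrable (fun w => ξ w • iteratedFDeriv ℝ m φ (y + ((2 : ℝ) ^ k)⁻¹ • w)) :=
      Continuous.integrable_of_hasCompactSupport (by fun_prop) hξc.smul_right
    have hint0 : Integrable ξ := hξ.integrable_of_hasCompactSupport hξc
    have e1 : iteratedFDeriv ℝ m φ y = ∫ w, ξ w • iteratedFDeriv ℝ m φ y := by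
      rw [integral_smul_const, hξ1, one_smul]
    rw [dist_eq_norm]
    nth_rewrite 1 [e1]
    rw [← integral_sub (hint0.smul_const _) hint]
    calc _ ≤ ∫ w, ‖ξ w‖ * (ε / (I + 1)) := by
          refine norm_integral_le_of_norm_le (hint0.norm.mul_const _) (Eventually.of_forall fun w => ?_)
          rw [← smul_sub, norm_smul]
          by_cases hw : ξ w = 0
          · simp [hw]
          gcongr
          rw [← dist_eq_norm]
          refine (hd ?_).le
          rw [dist_eq_norm]
          simp only [sub_add_cancel_left, norm_neg]
          rw [norm_smul, Real.norm_of_nonneg (by positivity)]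
          refine lt_of_le_of_lt ?_ hk
          gcongr
          have := hR' w hw
          have := le_abs_self R
          linarith
      _ = I * (ε / (I + 1)) := by rw [integral_mul_const]
      _ < ε := by
          rw [mul_div_assoc', div_lt_iff₀ (by positivity)]
          nlinarith

/-- translates -/
lemma aux_cont {d : ℕ} (G : DistributionR d)
    (ψ : (Fin d → ℝ) → ℝ) (hψ : ContDiff ℝ (⊤ : ℕ∞) ψ) (hψc : HasCompactSupport ψ) :
    Continuous (fun x => G.toFun (fun y => ψ (y - x))) := by
  obtain ⟨S, hS⟩ := hψc.isCompact.isBounded.subset_closedBall (0 : Fin d → ℝ)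
  have hS' : ∀ w, ψ w ≠ 0 → ‖w‖ ≤ S := fun w hw => by
    simpa using hS (subset_tsupport _ hw)
  rw [continuous_iff_seqContinuous]
  intro xs x hx
  apply G.cont'
  · intro n; fun_prop
  · fun_prop
  · obtain ⟨R, hR⟩ := (Metric.isBounded_range_of_tendsto xs hx).subset_closedBall 0
    refine ⟨Metric.closedBall 0 (S + R), isCompact_closedBall _ _, fun n => ?_⟩
    refine closure_minimal ?_ Metric.isClosed_closedBall
    intro y hy
    have e1 := hS' _ hy
    have e2 : ‖xs n‖ ≤ R := by simpa using hR (Set.mem_range_self n)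
    rw [mem_closedBall_zero_iff]
    calc ‖y‖ = ‖(y - xs n) + xs n‖ := by simp
      _ ≤ _ := norm_add_le _ _
      _ ≤ _ := by linarith
  · intro m
    have hcm : Continuous (iteratedFDeriv ℝ m ψ) :=
      hψ.continuous_iteratedFDeriv (by exact_mod_cast le_top)
    have hu := (hψc.iteratedFDeriv m).uniformContinuous_of_continuous hcm
    rw [Metric.uniformContinuous_iff] at hu
    rw [Metric.tendstoUniformly_iff]
    intro ε hε
    obtain ⟨δ, hδ, hd⟩ := hu ε hε
    filter_upwards [Metric.tendsto_nhds.1 hx δ hδ] with n hn y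
    simp only [iteratedFDeriv_comp_sub]
    apply hd
    rw [dist_sub_left, dist_comm]
    exact hn

open scoped Pointwise

lemma aux_simple_exists {d : ℕ} (K : Set (Fin d → ℝ)) (hK : IsCompact K) (δ : ℝ) (hδ : 0 < δ) :
    ∃ s : SimpleFunc (Fin d → ℝ) (Fin d → ℝ), ∀ x ∈ K, dist (s x) x < δ := by
  let e := TopologicalSpace.denseSeq (Fin d → ℝ)
  have hcov : K ⊆ ⋃ k, Metric.ball (e k) δ := by
    intro x _
    obtain ⟨k, hk⟩ := (TopologicalSpace.denseRange_denseSeq (Fin d → ℝ)).exists_dist_lt x hδ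
    exact Set.mem_iUnion.2 ⟨k, hk⟩
  obtain ⟨t, ht⟩ := hK.elim_finite_subcover _ (fun k => Metric.isOpen_ball) hcov
  refine ⟨SimpleFunc.nearestPt e (t.sup id), fun x hx => ?_⟩
  obtain ⟨k, hk, hxk⟩ := Set.mem_iUnion₂.1 (ht hx)
  have h1 := SimpleFunc.edist_nearestPt_le e x (Finset.le_sup (f := id) hk)
  simp only [id] at h1
  rw [edist_dist, edist_dist, ENNReal.ofReal_le_ofReal_iff dist_nonneg] at h1
  refine lt_of_le_of_lt h1 ?_
  rw [dist_comm]
  exact hxk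

lemma aux_simple_integral {d : ℕ} {V : Type*} [NormedAddCommGroup V] [NormedSpace ℝ V]
    [CompleteSpace V] (μ : Measure (Fin d → ℝ)) [IsFiniteMeasure μ]
    (s : SimpleFunc (Fin d → ℝ) (Fin d → ℝ)) (h : (Fin d → ℝ) → V) :
    Integrable (fun x => h (s x)) μ ∧
    ∫ x, h (s x) ∂μ = ∑ c ∈ s.range, μ.real (s ⁻¹' {c}) • h c := by
  refine ⟨(s.map h).integrable_of_isFiniteMeasure, ?_⟩
  have e : ∀ x, h (s x) = ∑ c ∈ s.range, (s ⁻¹' {c}).indicator (fun _ => h c) x := by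
    intro x
    rw [Finset.sum_eq_single (s x)]
    · simp
    · intro c _ hc
      simp [Set.indicator, Ne.symm hc]
    · intro hx
      exact absurd (SimpleFunc.mem_range_self s x) hx
  simp_rw [e]
  rw [integral_finsetSum]
  · refine Finset.sum_congr rfl fun c _ => ?_
    rw [integral_indicator_const _ (s.measurableSet_fiber c)]
  · intro c _
    exact (integrable_const _).indicator (s.measurableSet_fiber c)

lemma aux_riemann {d : ℕ} {V : Type*} [NormedAddCommGroup V] [NormedSpace ℝ V]
    [CompleteSpace V] (K : Set (Fin d → ℝ)) (hK : IsCompact K)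
    (s : SimpleFunc (Fin d → ℝ) (Fin d → ℝ)) (h : (Fin d → ℝ) → V) (hh : Continuous h)
    (hs : ∀ x, x ∉ K → h x = 0)
    (η : ℝ) (hη : ∀ x ∈ K, ‖h (s x) - h x‖ ≤ η) :
    ‖∑ c ∈ s.range, (volume.restrict K).real (s ⁻¹' {c}) • h c - ∫ x, h x‖
      ≤ η * volume.real K := by
  have : IsFiniteMeasure (volume.restrict K) :=
    ⟨by rw [Measure.restrict_apply_univ]; exact hK.measure_lt_top⟩
  obtain ⟨hi, he⟩ := aux_simple_integral (volume.restrict K) s h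
  rw [← he, ← setIntegral_eq_integral_of_forall_compl_eq_zero (s := K) hs,
    ← integral_sub hi (hh.continuousOn.integrableOn_compact hK)]
  exact norm_setIntegral_le_of_norm_le_const hK.measure_lt_top hη

lemma aux_norm {V : Type*} [NormedAddCommGroup V] [NormedSpace ℝ V] (a b : ℝ) (p q : V) :
    ‖a • p - b • q‖ ≤ ‖a‖ * ‖p - q‖ + ‖a - b‖ * ‖q‖ := by
  have e : a • p - b • q = a • (p - q) + (a - b) • q := by
    rw [smul_sub, sub_smul]; abel
  rw [e, ← norm_smul, ← norm_smul]
  exact norm_add_le _ _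

lemma aux_fubini {d : ℕ} (G : DistributionR d)
    (ψ : (Fin d → ℝ) → ℝ) (hψ : ContDiff ℝ (⊤ : ℕ∞) ψ) (hψc : HasCompactSupport ψ)
    (φ : (Fin d → ℝ) → ℝ) (hφ : Continuous φ) (hφc : HasCompactSupport φ) :
    G.toFun (fun y => ∫ x, φ x • ψ (y + (-1 : ℝ) • x)) =
      ∫ x, φ x • G.toFun (fun y => ψ (y - x)) := by
  set u : (Fin d → ℝ) → ℝ := fun x => G.toFun (fun y => ψ (y - x)) with hu
  have hucont : Continuous u := aux_cont G ψ hψ hψc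
  set K := tsupport φ with hK
  have hKc : IsCompact K := hφc
  choose s hs using fun n : ℕ => aux_simple_exists K hKc (1 / ((n : ℝ) + 1)) (by positivity)
  have hlim : Tendsto (fun n : ℕ => 1 / ((n : ℝ) + 1)) atTop (𝓝 0) :=
    tendsto_one_div_add_atTop_nhds_zero_nat
  have hφ0 : ∀ x, x ∉ K → φ x = 0 := fun x hx => image_eq_zero_of_notMem_tsupport hx
  set w : ℕ → (Fin d → ℝ) → ℝ := fun n c => (volume.restrict K).real (s n ⁻¹' {c}) with hw
  set v := volume.real K
  have hv : 0 ≤ v := measureReal_nonneg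
  -- the Riemann sums
  set S : ℕ → (Fin d → ℝ) → ℝ := fun n => ∑ c ∈ (s n).range, w n c • (φ c • fun y => ψ (y - c))
    with hS
  have hψm : ∀ c, ContDiff ℝ (⊤ : ℕ∞) (fun y => ψ (y - c)) := fun c => by fun_prop
  have hter : ∀ n c, ContDiff ℝ (⊤ : ℕ∞) (w n c • (φ c • fun y => ψ (y - c))) :=
    fun n c => ((hψm c).const_smul (φ c)).const_smul (w n c)
  have hGS : ∀ n, G.toFun (S n) = ∑ c ∈ (s n).range, w n c • (φ c • u c) := by
    intro n
    simp only [hS, map_sum, map_smul, hu]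
  have lim1 : Tendsto (fun n => G.toFun (S n)) atTop (𝓝 (∫ x, φ x • u x)) := by
    simp_rw [hGS]
    have hcs : HasCompactSupport (fun x => φ x • u x) := hφc.smul_right
    have hcc : Continuous (fun x => φ x • u x) := by fun_prop
    have huc := hcs.uniformContinuous_of_continuous hcc
    rw [Metric.uniformContinuous_iff] at huc
    rw [Metric.tendsto_nhds]
    intro ε hε
    obtain ⟨δ, hδ, hd⟩ := huc (ε / (v + 1)) (by positivity)
    filter_upwards [hlim.eventually_lt_const hδ] with n hn
    rw [dist_eq_norm]
    refine lt_of_le_of_lt (aux_riemann K hKc (s n) (fun x => φ x • u x) hcc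
      (fun x hx => by simp [hφ0 x hx]) (ε / (v + 1)) (fun x hx => ?_)) ?_
    · rw [← dist_eq_norm]
      exact (hd ((hs n x hx).trans hn)).le
    · rw [div_mul_eq_mul_div, div_lt_iff₀ (by positivity)]
      change ε * v < _
      nlinarith
  have lim2 : Tendsto (fun n => G.toFun (S n)) atTop
      (𝓝 (G.toFun (fun y => ∫ x, φ x • ψ (y + (-1 : ℝ) • x)))) := by
    apply G.cont'
    · intro n
      have := ContDiff.sum (s := (s n).range) fun c _ => hter n c
      convert this using 1
      ext y
      simp [hS]
    · exact aux_contDiff φ hφ hφc ψ hψ hψc (-1)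
    · refine ⟨K + tsupport ψ, hKc.add hψc, fun n => ?_⟩
      refine closure_minimal ?_ (hKc.add hψc).isClosed
      intro y hy
      have hy' : ∑ c ∈ (s n).range, w n c • (φ c • ψ (y - c)) ≠ 0 := by
        simpa [hS] using hy
      obtain ⟨c, -, hc⟩ := Finset.exists_ne_zero_of_sum_ne_zero hy'
      have hφn : φ c ≠ 0 := fun h => hc (by simp [h])
      have hψn : ψ (y - c) ≠ 0 := fun h => hc (by simp [h])
      exact Set.mem_add.2 ⟨c, subset_tsupport _ hφn, y - c, subset_tsupport _ hψn, by simp⟩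
    · intro m
      rw [aux_iter φ hφ hφc ψ hψ hψc (-1) m]
      have hcm : Continuous (iteratedFDeriv ℝ m ψ) :=
        hψ.continuous_iteratedFDeriv (by exact_mod_cast le_top)
      have hSm : ∀ n y, iteratedFDeriv ℝ m (S n) y =
          ∑ c ∈ (s n).range, w n c • (φ c • iteratedFDeriv ℝ m ψ (y + (-1 : ℝ) • c)) := by
        intro n y
        have hle : (m : WithTop ℕ∞) ≤ ((⊤ : ℕ∞) : WithTop ℕ∞) := by exact_mod_cast le_top
        rw [hS]
        simp only
        rw [iteratedFDeriv_sum_apply (fun c _ => ((hter n c).of_le hle).contDiffAt)]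
        refine Finset.sum_congr rfl fun c _ => ?_
        have h1 : ContDiff ℝ (⊤ : ℕ∞) (φ c • fun y => ψ (y - c)) := (hψm c).const_smul (φ c)
        rw [iteratedFDeriv_const_smul_apply (h1.of_le hle).contDiffAt,
          iteratedFDeriv_const_smul_apply ((hψm c).of_le hle).contDiffAt,
          iteratedFDeriv_comp_sub]
        simp [sub_eq_add_neg]
      have huψ := (hψc.iteratedFDeriv m).uniformContinuous_of_continuous hcm
      have huφ := hφc.uniformContinuous_of_continuous hφ
      obtain ⟨A, hA⟩ := hφc.exists_bound_of_continuous hφ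
      obtain ⟨B, hB⟩ := (hψc.iteratedFDeriv m).exists_bound_of_continuous hcm
      have hA0 : 0 ≤ A := (norm_nonneg _).trans (hA 0)
      have hB0 : 0 ≤ B := (norm_nonneg _).trans (hB 0)
      rw [Metric.uniformContinuous_iff] at huψ huφ
      rw [Metric.tendstoUniformly_iff]
      intro ε hε
      set κ := ε / ((v + 1) * (A + B + 1)) with hκ
      have hκ0 : 0 < κ := by positivity
      obtain ⟨δ₁, hδ₁, hd₁⟩ := huψ κ hκ0
      obtain ⟨δ₂, hδ₂, hd₂⟩ := huφ κ hκ0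
      filter_upwards [hlim.eventually_lt_const hδ₁, hlim.eventually_lt_const hδ₂] with n hn₁ hn₂ y
      rw [dist_comm, dist_eq_norm, hSm]
      refine lt_of_le_of_lt (aux_riemann K hKc (s n)
        (fun x => φ x • iteratedFDeriv ℝ m ψ (y + (-1 : ℝ) • x)) (by fun_prop)
        (fun x hx => by simp [hφ0 x hx]) (κ * (A + B)) (fun x hx => ?_)) ?_
      · refine (aux_norm _ _ _ _).trans ?_
        have e1 : ‖iteratedFDeriv ℝ m ψ (y + (-1 : ℝ) • s n x) -
            iteratedFDeriv ℝ m ψ (y + (-1 : ℝ) • x)‖ ≤ κ := by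
          rw [← dist_eq_norm]
          refine (hd₁ ?_).le
          have := (hs n x hx).trans hn₁
          simpa using this
        have e2 : ‖φ (s n x) - φ x‖ ≤ κ := by
          rw [← dist_eq_norm]
          exact (hd₂ ((hs n x hx).trans hn₂)).le
        calc _ ≤ A * κ + κ * B := by
              gcongr
              · exact hA _
              · exact hB _
          _ = _ := by ring
      · have : κ * ((v + 1) * (A + B + 1)) = ε := by
          rw [hκ]; field_simp
        change κ * (A + B) * v < ε
        nlinarith [mul_nonneg hκ0.le hv, mul_nonneg hκ0.le (add_nonneg hA0 hB0)]
  exact tendsto_nhds_unique lim2 lim1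

lemma aux_L1 {d : ℕ} (p : ℝ) (hp0 : 0 < p) (hp1 : p < 1) (u : (Fin d → ℝ) → ℝ) (hu : Continuous u)
    (r : ℝ) (hr : 0 < r) (N : ℝ≥0∞)
    (hN : (∫⁻ x, (ENNReal.ofReal (⨍ y in Metric.ball x r, |u y|)) ^ p) ^ (1 / p) ≤ N) :
    ∫⁻ x, ‖u x‖ₑ ≤ ENNReal.ofReal ((2 * r) ^ d) * ENNReal.ofReal (r ^ d) ^ (-(1 / p)) * N := by
  set A : (Fin d → ℝ) → ℝ≥0∞ := fun x => ENNReal.ofReal (⨍ y in Metric.ball x r, |u y|) with hA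
  set I := ∫⁻ x, A x ^ p with hI
  set a : (Fin d → ℝ) → ℝ≥0∞ := fun z => ∫⁻ y in Metric.ball z (r / 2), ‖u y‖ₑ with ha
  set v := ENNReal.ofReal (r ^ d) with hv
  set W := ENNReal.ofReal ((2 * r) ^ d) with hW
  have hv0 : v ≠ 0 := by simp [hv, hr]
  have hvt : v ≠ ⊤ := ENNReal.ofReal_ne_top
  have hWt : W ≠ ⊤ := ENNReal.ofReal_ne_top
  have hvb : ∀ z : Fin d → ℝ, volume (Metric.ball z (r / 2)) = v := by
    intro z
    rw [Real.volume_pi_ball _ (by positivity)]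
    simp [hv, mul_div_cancel₀]
  have hWb : ∀ z : Fin d → ℝ, volume (Metric.ball z r) = W := by
    intro z
    rw [Real.volume_pi_ball _ hr]
    simp [hW]
  have hav : ∀ x, ∫⁻ y in Metric.ball x r, ‖u y‖ₑ = W * A x := by
    intro x
    have hint : IntegrableOn (fun y => |u y|) (Metric.ball x r) :=
      (hu.abs.continuousOn.integrableOn_compact (isCompact_closedBall x r)).mono_set
        Metric.ball_subset_closedBall
    have e1 : ∫⁻ y in Metric.ball x r, ‖u y‖ₑ = ENNReal.ofReal (∫ y in Metric.ball x r, |u y|) := by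
      rw [ofReal_integral_eq_lintegral_ofReal hint (Eventually.of_forall fun _ => abs_nonneg _)]
      refine lintegral_congr fun y => ?_
      exact Real.enorm_eq_ofReal_abs _
    have hWr : volume.real (Metric.ball x r) = (2 * r) ^ d := by
      rw [measureReal_def, hWb, hW, ENNReal.toReal_ofReal (by positivity)]
    rw [e1, hA]
    simp only
    rw [setAverage_eq, hWr, hW, ← ENNReal.ofReal_mul (by positivity), smul_eq_mul,
      mul_inv_cancel_left₀ (by positivity)]
  have h1 : ∀ z, ∀ x ∈ Metric.ball z (r / 2), a z ≤ W * A x := by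
    intro z x hx
    rw [← hav]
    refine lintegral_mono_set (fun y hy => ?_)
    rw [Metric.mem_ball] at *
    calc dist y x ≤ dist y z + dist x z := dist_triangle_right _ _ _
      _ < r := by linarith
  have h1' : ∀ z, a z ≤ W * A z := fun z => h1 z z (Metric.mem_ball_self (by positivity))
  have hIN : I ≤ N ^ p := by
    have := ENNReal.rpow_le_rpow hN hp0.le
    rwa [← ENNReal.rpow_mul, one_div_mul_cancel hp0.ne', ENNReal.rpow_one] at this
  -- sup bound
  have h2 : ∀ z, a z ≤ W * v ^ (-(1 / p)) * N := by
    intro z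
    have e1 : v * a z ^ p ≤ W ^ p * N ^ p := by
      calc v * a z ^ p = ∫⁻ x in Metric.ball z (r / 2), a z ^ p := by
            rw [setLIntegral_const, hvb, mul_comm]
        _ ≤ ∫⁻ x in Metric.ball z (r / 2), W ^ p * A x ^ p := by
            refine setLIntegral_mono' Metric.isOpen_ball.measurableSet fun x hx => ?_
            rw [← ENNReal.mul_rpow_of_nonneg _ _ hp0.le]
            exact ENNReal.rpow_le_rpow (h1 z x hx) hp0.le
        _ ≤ ∫⁻ x, W ^ p * A x ^ p := setLIntegral_le_lintegral _ _
        _ = W ^ p * I := by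
            rw [lintegral_const_mul' _ _ (ENNReal.rpow_ne_top_of_nonneg hp0.le hWt)]
        _ ≤ _ := by gcongr
    have e2 : a z ^ p ≤ (W * v ^ (-(1 / p)) * N) ^ p := by
      rw [ENNReal.mul_rpow_of_nonneg _ _ hp0.le, ENNReal.mul_rpow_of_nonneg _ _ hp0.le,
        ← ENNReal.rpow_mul, neg_mul, one_div_mul_cancel hp0.ne', ENNReal.rpow_neg_one]
      calc a z ^ p = v⁻¹ * (v * a z ^ p) := by
            rw [← mul_assoc, ENNReal.inv_mul_cancel hv0 hvt, one_mul]
        _ ≤ v⁻¹ * (W ^ p * N ^ p) := by gcongr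
        _ = _ := by ring
    exact (ENNReal.rpow_le_rpow_iff hp0).1 e2
  have h3 : ∫⁻ z, a z = v * ∫⁻ x, ‖u x‖ₑ := by
    have e1 : ∀ z, a z = ∫⁻ y, (Metric.ball y (r / 2)).indicator (fun _ => ‖u y‖ₑ) z := by
      intro z
      rw [ha]
      simp only
      rw [← lintegral_indicator Metric.isOpen_ball.measurableSet]
      refine lintegral_congr fun y => ?_
      simp only [Set.indicator, Metric.mem_ball, dist_comm]
    simp_rw [e1]
    rw [lintegral_lintegral_swap]
    · rw [← lintegral_const_mul' _ _ hvt]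
      refine lintegral_congr fun y => ?_
      rw [lintegral_indicator_const Metric.isOpen_ball.measurableSet, hvb, mul_comm]
    · refine Measurable.aemeasurable ?_
      have hS : MeasurableSet {q : (Fin d → ℝ) × (Fin d → ℝ) | dist q.1 q.2 < r / 2} :=
        (isOpen_lt (by fun_prop) (by fun_prop)).measurableSet
      have : (Function.uncurry fun z y => (Metric.ball y (r / 2)).indicator (fun _ => ‖u y‖ₑ) z)
          = {q : (Fin d → ℝ) × (Fin d → ℝ) | dist q.1 q.2 < r / 2}.indicator
            (fun q => ‖u q.2‖ₑ) := by
        ext q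
        simp [Function.uncurry, Set.indicator, Metric.mem_ball]
      rw [this]
      exact Measurable.indicator (hu.measurable.comp measurable_snd).enorm hS
  set Z := W * v ^ (-(1 / p)) * N with hZ
  have h1p : (0:ℝ) < 1 - p := by linarith
  have h4 : ∫⁻ z, a z ≤ Z ^ (1 - p) * (W ^ p * N ^ p) := by
    by_cases hNt : N = ⊤
    · subst hNt
      have hW0 : W ≠ 0 := by simp [hW, hr]
      have hvz : v ^ (-(1 / p)) ≠ 0 := by
        simp [ENNReal.rpow_eq_zero_iff, hv0, hvt]
      have : Z = ⊤ := by
        rw [hZ, ENNReal.mul_top]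
        exact mul_ne_zero hW0 hvz
      rw [this, ENNReal.top_rpow_of_pos h1p, ENNReal.top_rpow_of_pos hp0, ENNReal.mul_top,
        ENNReal.top_mul_top]
      · exact le_top
      · simp [ENNReal.rpow_eq_zero_iff, hW0, hWt]
    have hZt : Z ≠ ⊤ := by
      refine ENNReal.mul_ne_top (ENNReal.mul_ne_top hWt ?_) hNt
      exact ENNReal.rpow_ne_top_of_ne_zero hv0 hvt
    calc ∫⁻ z, a z ≤ ∫⁻ z, Z ^ (1 - p) * (W ^ p * A z ^ p) := by
          refine lintegral_mono fun z => ?_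
          have e : a z = a z ^ (1 - p) * a z ^ p := by
            rw [← ENNReal.rpow_add_of_nonneg _ _ h1p.le hp0.le]; simp
          rw [e, ← ENNReal.mul_rpow_of_nonneg _ _ hp0.le]
          gcongr
          · exact h2 z
          · exact h1' z
      _ = Z ^ (1 - p) * (W ^ p * I) := by
          rw [lintegral_const_mul' _ _ (ENNReal.rpow_ne_top_of_nonneg h1p.le hZt),
            lintegral_const_mul' _ _ (ENNReal.rpow_ne_top_of_nonneg hp0.le hWt)]
      _ ≤ _ := by gcongr
  have h5 : W ^ p * N ^ p = v * Z ^ p := by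
    rw [hZ, ENNReal.mul_rpow_of_nonneg _ _ hp0.le, ENNReal.mul_rpow_of_nonneg _ _ hp0.le,
        ← ENNReal.rpow_mul, neg_mul, one_div_mul_cancel hp0.ne', ENNReal.rpow_neg_one]
    calc _ = (v * v⁻¹) * (W ^ p * N ^ p) := by rw [ENNReal.mul_inv_cancel hv0 hvt, one_mul]
      _ = _ := by ring
  rw [h3, h5, mul_left_comm, ← ENNReal.rpow_add_of_nonneg _ _ h1p.le hp0.le, sub_add_cancel,
    ENNReal.rpow_one] at h4
  exact (ENNReal.mul_le_mul_iff_right hv0 hvt).1 h4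

lemma aux_subst {d : ℕ} (k : ℕ) (ξ φ : (Fin d → ℝ) → ℝ) (y : Fin d → ℝ) :
    ∫ w, ξ w • φ (y + ((2 : ℝ) ^ k)⁻¹ • w) =
      ∫ x, φ x • (fun z => dil d k ξ (-z)) (y + (-1 : ℝ) • x) := by
  have h2 : ((2 : ℝ) ^ k) ≠ 0 := by positivity
  have e : ∀ x, φ x • (fun z => dil d k ξ (-z)) (y + (-1 : ℝ) • x) =
      (fun w => (2 : ℝ) ^ (d * k) * (ξ w • φ (y + ((2 : ℝ) ^ k)⁻¹ • w)))
        ((2 : ℝ) ^ k • (x - y)) := by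
    intro x
    have : -(y + (-1 : ℝ) • x) = x - y := by simp; abel
    simp only [dil, this, smul_smul, inv_mul_cancel₀ h2, one_smul, add_sub_cancel, smul_eq_mul]
    ring
  simp_rw [e]
  rw [integral_sub_right_eq_self (fun x => (fun w => (2 : ℝ) ^ (d * k) *
    (ξ w • φ (y + ((2 : ℝ) ^ k)⁻¹ • w))) ((2 : ℝ) ^ k • x)) y, Measure.integral_comp_smul volume
    (fun w => (2 : ℝ) ^ (d * k) * (ξ w • φ (y + ((2 : ℝ) ^ k)⁻¹ • w))) ((2 : ℝ) ^ k),
    integral_const_mul]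
  rw [abs_of_pos (by positivity), Module.finrank_fin_fun, ← pow_mul, mul_comm k d, smul_eq_mul,
    inv_mul_cancel_left₀ (by positivity)]

end aux

/-- Uniqueness of reconstruction in Besov spaces with `p ∈ (0,1)`, `ν > d(1/p-1)`:
if the local averages of the mollified difference `(f - f̃) * ξ^{(k)}` have `L^p`
quasinorm bounded by `M 2^{-νk}`, then `f = f̃`. -/
theorem besov_uniqueness_p_lt_one {d : ℕ} (p : ℝ) (hp0 : 0 < p) (hp1 : p < 1)
    (q : ℝ≥0∞) (hq : 0 < q) (ν : ℝ) (hν : (d : ℝ) * (1 / p - 1) < ν)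
    (f ftilde : DistributionR d)
    (ξ : (Fin d → ℝ) → ℝ) (hξs : ContDiff ℝ (⊤ : ℕ∞) ξ) (hξc : HasCompactSupport ξ)
    (hξ1 : ∫ y, ξ y = 1) (M : ℝ)
    (hbd : ∀ k : ℕ,
      (∫⁻ x, (ENNReal.ofReal
          (⨍ y in Metric.ball x ((2 : ℝ) ^ (-(k : ℝ))),
            |distribConv f (dil d k ξ) y - distribConv ftilde (dil d k ξ) y|)) ^ p)
        ^ (1 / p)
        ≤ ENNReal.ofReal M * (2 : ℝ≥0∞) ^ (-(ν * k))) :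
    f.EqD ftilde := by
  intro φ hφ hφc
  let G : DistributionR d :=
    ⟨f.toFun - ftilde.toFun, fun φs φ₀ h1 h2 h3 h4 =>
      (f.cont' φs φ₀ h1 h2 h3 h4).sub (ftilde.cont' φs φ₀ h1 h2 h3 h4)⟩
  have hG : ∀ η, G.toFun η = f.toFun η - ftilde.toFun η := fun η => rfl
  suffices h : G.toFun φ = 0 from sub_eq_zero.1 ((hG φ).symm.trans h)
  let ψ : ℕ → (Fin d → ℝ) → ℝ := fun k z => dil d k ξ (-z)
  have hψ : ∀ k, ContDiff ℝ (⊤ : ℕ∞) (ψ k) := by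
    intro k
    simp only [ψ, dil]
    fun_prop
  have hψc : ∀ k, HasCompactSupport (ψ k) := by
    intro k
    have h2 : -((2 : ℝ) ^ k) ≠ 0 := neg_ne_zero.2 (by positivity)
    have h1 : HasCompactSupport fun z : Fin d → ℝ => ξ ((-((2 : ℝ) ^ k)) • z) := hξc.comp_smul h2
    have h3 : HasCompactSupport fun z : Fin d → ℝ =>
        (2 : ℝ) ^ (d * k) * ξ ((-((2 : ℝ) ^ k)) • z) := h1.mul_left
    convert h3 using 3 with z
    simp [ψ, dil]
  let u : ℕ → (Fin d → ℝ) → ℝ := fun k x => G.toFun (fun y => ψ k (y - x))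
  have hu : ∀ k, Continuous (u k) := fun k => aux_cont G (ψ k) (hψ k) (hψc k)
  have hueq : ∀ k y, distribConv f (dil d k ξ) y - distribConv ftilde (dil d k ξ) y = u k y := by
    intro k y
    simp only [distribConv, u, ψ, hG, neg_sub]
  have hL1 : ∀ k : ℕ, ∫⁻ x, ‖u k x‖ₑ ≤
      ENNReal.ofReal (2 ^ d) * ENNReal.ofReal M *
        (2 : ℝ≥0∞) ^ ((k : ℝ) * (d * (1 / p - 1) - ν)) := by
    intro k
    have h := hbd k
    simp_rw [hueq] at h
    refine (aux_L1 p hp0 hp1 (u k) (hu k) _ (by positivity) _ h).trans (le_of_eq ?_)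
    have e1 : ((2 : ℝ) ^ (-(k : ℝ))) ^ d = (2 : ℝ) ^ (-((k : ℝ) * d)) := by
      rw [← Real.rpow_natCast, ← Real.rpow_mul (by norm_num)]; ring_nf
    have e2 : ENNReal.ofReal ((2 : ℝ) ^ (-((k : ℝ) * d))) = (2 : ℝ≥0∞) ^ (-((k : ℝ) * d)) := by
      rw [← ENNReal.ofReal_rpow_of_pos (by norm_num)]; simp
    have t0 : (2 : ℝ≥0∞) ≠ 0 := by norm_num
    have t1 : (2 : ℝ≥0∞) ≠ ⊤ := by norm_num
    rw [mul_pow, ENNReal.ofReal_mul (by positivity), e1, e2, ← ENNReal.rpow_mul]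
    have e3 : (2 : ℝ≥0∞) ^ ((k : ℝ) * (d * (1 / p - 1) - ν)) =
        (2 : ℝ≥0∞) ^ (-((k : ℝ) * d)) * (2 : ℝ≥0∞) ^ (-((k : ℝ) * d) * (-(1 / p)))
          * (2 : ℝ≥0∞) ^ (-(ν * k)) := by
      rw [← ENNReal.rpow_add _ _ t0 t1, ← ENNReal.rpow_add _ _ t0 t1]
      congr 1
      ring
    rw [e3]
    ring
  have hlim0 : Tendsto (fun k : ℕ => ENNReal.ofReal (2 ^ d) * ENNReal.ofReal M *
        (2 : ℝ≥0∞) ^ ((k : ℝ) * (d * (1 / p - 1) - ν))) atTop (nhds 0) := by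
    have hneg : (d : ℝ) * (1 / p - 1) - ν < 0 := by linarith
    have hb : (2 : ℝ≥0∞) ^ ((d : ℝ) * (1 / p - 1) - ν) < 1 :=
      ENNReal.rpow_lt_one_of_one_lt_of_neg (by norm_num) hneg
    have h1 := ENNReal.tendsto_pow_atTop_nhds_zero_of_lt_one hb
    have h2 := ENNReal.Tendsto.const_mul (a := ENNReal.ofReal (2 ^ d) * ENNReal.ofReal M) h1
      (Or.inr (ENNReal.mul_ne_top ENNReal.ofReal_ne_top ENNReal.ofReal_ne_top))
    rw [mul_zero] at h2
    refine h2.congr fun k => ?_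
    rw [← ENNReal.rpow_natCast, ← ENNReal.rpow_mul, mul_comm (k : ℝ)]
  have happ := aux_approx G ξ hξs.continuous hξc hξ1 φ hφ hφc
  have hid : ∀ k : ℕ, G.toFun (fun y => ∫ w, ξ w • φ (y + ((2 : ℝ) ^ k)⁻¹ • w)) =
      ∫ x, φ x • u k x := by
    intro k
    rw [← aux_fubini G (ψ k) (hψ k) (hψc k) φ hφ.continuous hφc]
    congr 1
    ext y
    exact aux_subst k ξ φ y
  simp_rw [hid] at happ
  obtain ⟨B, hB⟩ := hφc.exists_bound_of_continuous hφ.continuous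
  have hz : Tendsto (fun k => ∫ x, φ x • u k x) atTop (nhds 0) := by
    rw [tendsto_zero_iff_enorm_tendsto_zero]
    have hlim1 := ENNReal.Tendsto.const_mul (a := ENNReal.ofReal B) hlim0
      (Or.inr ENNReal.ofReal_ne_top)
    rw [mul_zero] at hlim1
    refine tendsto_of_tendsto_of_tendsto_of_le_of_le tendsto_const_nhds hlim1
      (fun _ => bot_le) fun k => ?_
    calc ‖∫ x, φ x • u k x‖ₑ ≤ ∫⁻ x, ‖φ x • u k x‖ₑ := enorm_integral_le_lintegral_enorm _
      _ ≤ ∫⁻ x, ENNReal.ofReal B * ‖u k x‖ₑ := by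
          refine lintegral_mono fun x => ?_
          rw [enorm_smul]
          gcongr
          rw [← ofReal_norm]
          exact ENNReal.ofReal_le_ofReal (hB x)
      _ = ENNReal.ofReal B * ∫⁻ x, ‖u k x‖ₑ := lintegral_const_mul' _ _ ENNReal.ofReal_ne_top
      _ ≤ _ := by gcongr; exact hL1 k
  exact tendsto_nhds_unique happ hz
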